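/- Let ρ ∈ 𝓢(ℝ²) be a Schwartz function and i, j ∈ {1, 2}. There exists a constant C > 0, depending only on ρ, with the following property. Let k ≥ m ≥ 2 be integers, let S ≥ 0, and let v : ℝ² → ℝ be a measurable function such that v = 0 almost everywhere on Σ_{k+m} and such that ∫_{Σ_{k+m(l+1)} \ Σ_{k+ml}} |v|² ≤ (k + ml) S for every integer l ≥ 1. Set f := ρ∗v (a smooth bounded function) and define 𝓘f(x) := ∫_{ℝ²} γ_{ij}(x−y) [ f(x) − f(y) − ∇f(x)·(x−y) 1_{‖x−y‖ ≤ m/2} ] dy. Then ( ∫_{Σ_{k+1}} |𝓘f|² )^{1/2} ≤ C (k²/m^{5/2}) S^{1/2}. -/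

import Mathlib

open MeasureTheory
open scoped ENNReal SchwartzMap

/-- The closed square `Σ_r = {x ∈ ℝ² : max(|x₁|, |x₂|) ≤ r}`. -/
def Sig (r : ℝ) : Set (EuclideanSpace ℝ (Fin 2)) :=
  {x | max |x 0| |x 1| ≤ r}

/-- The kernel `γ_{ij}(z) = δ_{ij}/‖z‖³ − 3 z_i z_j/‖z‖⁵` on `ℝ²`. -/
noncomputable def gam (i j : Fin 2) (z : EuclideanSpace ℝ (Fin 2)) : ℝ :=
  (if i = j then (1 : ℝ) else 0) / ‖z‖ ^ 3 - 3 * z i * z j / ‖z‖ ^ 5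

/-- The singular integral operator `I_K^{ij}` with cutoff parameter `K`. -/
noncomputable def IopK (i j : Fin 2) (K : ℝ) (f : EuclideanSpace ℝ (Fin 2) → ℝ)
    (x : EuclideanSpace ℝ (Fin 2)) : ℝ :=
  ∫ y, gam i j (x - y) *
    (f x - f y - (if ‖x - y‖ ≤ K then fderiv ℝ f x (x - y) else 0))

theorem measurableSet_Sig (r : ℝ) : MeasurableSet (Sig r) := by
  unfold Sig
  exact measurableSet_le (by fun_prop) measurable_const

theorem mem_Sig_iff {r : ℝ} {x : EuclideanSpace ℝ (Fin 2)} :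
    x ∈ Sig r ↔ |x 0| ≤ r ∧ |x 1| ≤ r :=
  max_le_iff (a := |x 0|) (b := |x 1|)

theorem volume_Sig {r : ℝ} (hr : 0 ≤ r) : volume (Sig r) = ENNReal.ofReal (4 * r ^ 2) := by
  have hpre : Sig r = (WithLp.ofLp : EuclideanSpace ℝ (Fin 2) → Fin 2 → ℝ) ⁻¹'
      Set.Icc (fun _ => -r) (fun _ => r) := by
    ext x
    simp only [mem_Sig_iff, Set.mem_preimage, Set.mem_Icc, Pi.le_def, Fin.forall_fin_two, abs_le]
    tauto
  rw [hpre, (PiLp.volume_preserving_ofLp (Fin 2)).measure_preimage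
    measurableSet_Icc.nullMeasurableSet, Real.volume_Icc_pi]
  simp only [Fin.prod_univ_two]
  rw [← ENNReal.ofReal_mul (by linarith)]
  congr 1
  ring

theorem Sig_subset_Sig {r s : ℝ} (h : r ≤ s) : Sig r ⊆ Sig s := fun _ hx => le_trans hx h

theorem sub_le_norm_of_mem_Sig_of_notMem_Sig {a b : ℝ} {x z : EuclideanSpace ℝ (Fin 2)}
    (hx : x ∈ Sig a) (hz : z ∉ Sig b) : b - a ≤ ‖x - z‖ := by
  have key : ∀ i : Fin 2, |z i| - |x i| ≤ ‖x - z‖ := fun i => by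
    have h1 := PiLp.norm_apply_le (x - z) i
    rw [PiLp.sub_apply, Real.norm_eq_abs] at h1
    have h2 := abs_sub_abs_le_abs_sub (z i) (x i)
    rw [abs_sub_comm] at h2
    linarith
  rw [mem_Sig_iff] at hx hz
  have h0 := key 0
  have h1 := key 1
  by_contra! hc
  exact hz ⟨by linarith [hx.1], by linarith [hx.2]⟩

/-- Cauchy–Schwarz on a set, in terms of upper bounds for the two factors. -/
theorem setLIntegral_abs_le_of_sq {α : Type*} [MeasurableSpace α] {μ : Measure α} {s : Set α}
    {v : α → ℝ} (hv : Measurable v) {a b : ℝ} (ha : 0 ≤ a)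
    (hs : μ s ≤ ENNReal.ofReal a)
    (h : ∫⁻ x in s, ENNReal.ofReal (v x ^ 2) ∂μ ≤ ENNReal.ofReal b) (hb : 0 ≤ b) :
    ∫⁻ x in s, ENNReal.ofReal |v x| ∂μ ≤ ENNReal.ofReal (√(b * a)) := by
  have H := ENNReal.lintegral_mul_le_Lp_mul_Lq (μ.restrict s) Real.HolderConjugate.two_two
    (f := fun x => ENNReal.ofReal |v x|) (g := fun _ => 1) (by fun_prop) (by fun_prop)
  simp only [Pi.mul_apply, mul_one, ENNReal.one_rpow, lintegral_const, one_mul,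
    Measure.restrict_apply_univ] at H
  have hsq : ∀ x, ENNReal.ofReal |v x| ^ (2 : ℝ) = ENNReal.ofReal (v x ^ 2) := fun x => by
    rw [ENNReal.ofReal_rpow_of_nonneg (abs_nonneg _) (by norm_num), Real.rpow_two, sq_abs]
  simp only [hsq] at H
  refine H.trans ?_
  rw [Real.sqrt_eq_rpow, Real.mul_rpow hb ha, ENNReal.ofReal_mul (by positivity),
    ← ENNReal.ofReal_rpow_of_nonneg hb (by norm_num),
    ← ENNReal.ofReal_rpow_of_nonneg ha (by norm_num)]
  gcongr

/-- The weighted integral of `v` seen from the inner square. -/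
theorem exists_lintegral_weight_le : ∃ C : ℝ, 0 < C ∧ ∀ k m : ℕ, 2 ≤ m → m ≤ k → ∀ S : ℝ, 0 ≤ S →
    ∀ v : EuclideanSpace ℝ (Fin 2) → ℝ, Measurable v →
    (∀ᵐ x, x ∈ Sig ((k : ℝ) + m) → v x = 0) →
    (∀ l : ℕ, 1 ≤ l →
      ∫⁻ x in Sig ((k : ℝ) + m * (l + 1)) \ Sig ((k : ℝ) + m * l),
        ENNReal.ofReal (v x ^ 2) ≤ ENNReal.ofReal (((k : ℝ) + m * l) * S)) →
    ∀ x ∈ Sig ((k : ℝ) + 1),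
      ∫⁻ z, ENNReal.ofReal (((1 + ‖x - z‖) ^ 3)⁻¹ * |v z|)
        ≤ ENNReal.ofReal (C * k / (m : ℝ) ^ ((5 : ℝ) / 2) * √S) := by
  have hsum : Summable fun l : ℕ => (((l : ℝ) + 1) ^ 2)⁻¹ := by
    have := (summable_nat_add_iff 1).2 (Real.summable_nat_pow_inv.2 (by norm_num : 1 < 2))
    simpa using this
  refine ⟨8 * (∑' l : ℕ, (((l : ℝ) + 1) ^ 2)⁻¹) + 1, ?_, ?_⟩
  · have : 0 ≤ ∑' l : ℕ, (((l : ℝ) + 1) ^ 2)⁻¹ := tsum_nonneg fun l => by positivity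
    positivity
  intro k m hm hmk S hS v hv hv0 hann x hx
  have hm0 : (2 : ℝ) ≤ m := by exact_mod_cast hm
  have hmk' : (m : ℝ) ≤ k := by exact_mod_cast hmk
  have hm52 : (m : ℝ) ^ ((5 : ℝ) / 2) = m ^ 2 * √m := by
    rw [Real.sqrt_eq_rpow, ← Real.rpow_natCast, ← Real.rpow_add (by linarith)]
    norm_num
  set A : ℕ → Set (EuclideanSpace ℝ (Fin 2)) := fun l =>
    Sig ((k : ℝ) + m * ((l + 1 : ℕ) + 1)) \ Sig ((k : ℝ) + m * (l + 1 : ℕ)) with hA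
  have hcover : (Sig ((k : ℝ) + m))ᶜ ⊆ ⋃ l, A l := by
    intro z hz
    have hex : ∃ n : ℕ, z ∈ Sig ((k : ℝ) + m * (n + 1)) := by
      obtain ⟨n, hn⟩ := exists_nat_ge (max |z 0| |z 1|)
      refine ⟨n, hn.trans ?_⟩
      have : (0 : ℝ) ≤ n := by positivity
      nlinarith
    classical
    have hn := Nat.find_spec hex
    rcases hN : Nat.find hex with _ | n
    · rw [hN] at hn
      exact absurd (by simpa using hn) hz
    · rw [hN] at hn
      have := Nat.find_min hex (m := n) (by omega)
      refine Set.mem_iUnion.2 ⟨n, by exact_mod_cast hn, by exact_mod_cast this⟩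
  have hterm : ∀ l, ∫⁻ z in A l, ENNReal.ofReal (((1 + ‖x - z‖) ^ 3)⁻¹ * |v z|)
      ≤ ENNReal.ofReal (8 * k / (m : ℝ) ^ ((5 : ℝ) / 2) * √S * (((l : ℝ) + 1) ^ 2)⁻¹) := by
    intro l
    have hl : (0 : ℝ) ≤ l := by positivity
    set r : ℝ := (k : ℝ) + m * (l + 1) with hr
    have hrm : (m : ℝ) * (l + 1) ≤ r := by linarith
    have hr0 : 0 ≤ r := by positivity
    have hAm : MeasurableSet (A l) := (measurableSet_Sig _).diff (measurableSet_Sig _)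
    have hdist : ∀ z ∈ A l, (m : ℝ) * (l + 1) ≤ 1 + ‖x - z‖ := fun z hz => by
      have := sub_le_norm_of_mem_Sig_of_notMem_Sig hx hz.2
      push_cast at this
      linarith
    have hvol : volume (A l) ≤ ENNReal.ofReal (12 * m * r) := by
      rw [hA, measure_sdiff (Sig_subset_Sig (by push_cast; nlinarith))
        (measurableSet_Sig _).nullMeasurableSet
        (by rw [volume_Sig (by positivity)]; exact ENNReal.ofReal_ne_top),
        volume_Sig (by positivity), volume_Sig (by positivity),
        ← ENNReal.ofReal_sub _ (by positivity)]
      refine ENNReal.ofReal_le_ofReal ?_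
      push_cast
      have : (m : ℝ) * m ≤ m * r := by nlinarith
      nlinarith
    have hCS := setLIntegral_abs_le_of_sq hv (by positivity) hvol (hann (l + 1) (by omega))
      (by positivity)
    calc ∫⁻ z in A l, ENNReal.ofReal (((1 + ‖x - z‖) ^ 3)⁻¹ * |v z|)
        ≤ ∫⁻ z in A l, ENNReal.ofReal ((((m : ℝ) * (l + 1)) ^ 3)⁻¹) * ENNReal.ofReal |v z| := by
          refine setLIntegral_mono' hAm fun z hz => ?_
          rw [← ENNReal.ofReal_mul (by positivity)]
          have := hdist z hz
          gcongr
      _ = ENNReal.ofReal ((((m : ℝ) * (l + 1)) ^ 3)⁻¹) * ∫⁻ z in A l, ENNReal.ofReal |v z| :=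
          lintegral_const_mul' _ _ ENNReal.ofReal_ne_top
      _ ≤ ENNReal.ofReal ((((m : ℝ) * (l + 1)) ^ 3)⁻¹) *
          ENNReal.ofReal √(((k : ℝ) + m * (l + 1 : ℕ)) * S * (12 * m * r)) := by
        gcongr
      _ ≤ _ := by
          rw [← ENNReal.ofReal_mul (by positivity)]
          refine ENNReal.ofReal_le_ofReal ?_
          push_cast
          rw [← hr, hm52]
          have h1 : √(r * S * (12 * m * r)) ≤ 4 * r * √m * √S := by
            rw [Real.sqrt_le_left (by positivity)]
            rw [mul_pow, mul_pow, Real.sq_sqrt hS, Real.sq_sqrt (by positivity)]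
            have : 0 ≤ r * S * (m * r) := by positivity
            nlinarith
          have h2 : r ≤ 2 * k * (l + 1) := by nlinarith
          have hsm : √(m : ℝ) * √m = m := Real.mul_self_sqrt (by positivity)
          have hsm0 : 0 < √(m : ℝ) := Real.sqrt_pos.2 (by linarith)
          calc (((m : ℝ) * (l + 1)) ^ 3)⁻¹ * √(r * S * (12 * m * r))
              ≤ (((m : ℝ) * (l + 1)) ^ 3)⁻¹ * (4 * (2 * k * (l + 1)) * √m * √S) := by
                gcongr
                exact h1.trans (by gcongr)
            _ = 8 * k / (m ^ 2 * √m) * √S * (((l : ℝ) + 1) ^ 2)⁻¹ := by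
                have : (m : ℝ) ^ 3 = m ^ 2 * (√m * √m) := by rw [hsm]; ring
                rw [mul_pow, this]
                field_simp
                ring
  have hzero : ∫⁻ z in Sig ((k : ℝ) + m), ENNReal.ofReal (((1 + ‖x - z‖) ^ 3)⁻¹ * |v z|) = 0 := by
    rw [setLIntegral_congr_fun_ae (measurableSet_Sig _) (g := fun _ => 0), lintegral_zero]
    filter_upwards [hv0] with z hz hzm
    simp [hz hzm]
  rw [← lintegral_add_compl _ (measurableSet_Sig ((k : ℝ) + m)), hzero, zero_add]
  calc ∫⁻ z in (Sig ((k : ℝ) + m))ᶜ, ENNReal.ofReal (((1 + ‖x - z‖) ^ 3)⁻¹ * |v z|)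
      ≤ ∫⁻ z in ⋃ l, A l, ENNReal.ofReal (((1 + ‖x - z‖) ^ 3)⁻¹ * |v z|) :=
        lintegral_mono_set hcover
    _ ≤ ∑' l, ∫⁻ z in A l, ENNReal.ofReal (((1 + ‖x - z‖) ^ 3)⁻¹ * |v z|) :=
        lintegral_iUnion_le _ _
    _ ≤ ∑' l : ℕ, ENNReal.ofReal
          (8 * k / (m : ℝ) ^ ((5 : ℝ) / 2) * √S * (((l : ℝ) + 1) ^ 2)⁻¹) :=
        ENNReal.tsum_le_tsum hterm
    _ = ENNReal.ofReal (∑' l : ℕ,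
          8 * k / (m : ℝ) ^ ((5 : ℝ) / 2) * √S * (((l : ℝ) + 1) ^ 2)⁻¹) :=
        (ENNReal.ofReal_tsum_of_nonneg (fun l => by positivity) (hsum.mul_left _)).symm
    _ ≤ _ := by
        refine ENNReal.ofReal_le_ofReal ?_
        rw [tsum_mul_left]
        have : 0 ≤ 1 * k / (m : ℝ) ^ ((5 : ℝ) / 2) * √S := by positivity
        linear_combination this

theorem SchwartzMap.exists_norm_le_inv_one_add_pow {E F : Type*} [NormedAddCommGroup E]
    [NormedSpace ℝ E] [NormedAddCommGroup F] [NormedSpace ℝ F] (g : 𝓢(E, F)) (n : ℕ) :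
    ∃ A : ℝ, ∀ u, ‖g u‖ ≤ A * ((1 + ‖u‖) ^ n)⁻¹ := by
  refine ⟨2 ^ n * (Finset.Iic (n, 0)).sup (fun m => SchwartzMap.seminorm ℝ m.1 m.2) g,
    fun u => ?_⟩
  have := SchwartzMap.one_add_le_sup_seminorm_apply (𝕜 := ℝ) (m := (n, 0)) le_rfl le_rfl g u
  rw [norm_iteratedFDeriv_zero] at this
  rw [← div_eq_mul_inv, le_div_iff₀ (by positivity), mul_comm]
  exact this

theorem inv_pow_mul_inv_pow_le {E : Type*} [SeminormedAddCommGroup E] (x y z : E) (n : ℕ) :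
    ((1 + ‖x - y‖) ^ n)⁻¹ * ((1 + ‖y - z‖) ^ n)⁻¹ ≤ ((1 + ‖x - z‖) ^ n)⁻¹ := by
  rw [← mul_inv, ← mul_pow]
  have := norm_sub_le_norm_sub_add_norm_sub x y z
  gcongr
  nlinarith [norm_nonneg (x - y), norm_nonneg (y - z)]

theorem abs_gam_le (i j : Fin 2) (z : EuclideanSpace ℝ (Fin 2)) :
    |gam i j z| ≤ 4 * (‖z‖ ^ 3)⁻¹ := by
  rcases eq_or_ne z 0 with rfl | hz
  · simp [gam]
  have hz : 0 < ‖z‖ := norm_pos_iff.2 hz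
  have h1 : |z i| ≤ ‖z‖ := PiLp.norm_apply_le z i
  have h2 : |z j| ≤ ‖z‖ := PiLp.norm_apply_le z j
  have h3 : |(if i = j then (1 : ℝ) else 0) / ‖z‖ ^ 3| ≤ (‖z‖ ^ 3)⁻¹ := by
    rw [abs_div, abs_of_pos (pow_pos hz 3), div_eq_mul_inv]
    split_ifs <;> simp
  have h4 : |3 * z i * z j / ‖z‖ ^ 5| ≤ 3 * (‖z‖ ^ 3)⁻¹ := by
    rw [abs_div, abs_of_pos (pow_pos hz 5), abs_mul, abs_mul, abs_of_pos (by norm_num : (0:ℝ) < 3)]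
    calc 3 * |z i| * |z j| / ‖z‖ ^ 5 ≤ 3 * ‖z‖ * ‖z‖ / ‖z‖ ^ 5 := by gcongr
      _ = _ := by field_simp
  calc |gam i j z| ≤ _ := abs_sub _ _
    _ ≤ _ := by linarith

theorem integrable_inv_one_add_norm_pow_three :
    Integrable fun u : EuclideanSpace ℝ (Fin 2) => ((1 + ‖u‖) ^ 3)⁻¹ := by
  have := integrable_one_add_norm (E := EuclideanSpace ℝ (Fin 2)) (μ := volume) (r := 3)
    (by simp; norm_num)
  refine this.congr (.of_forall fun u => ?_)
  simp only
  rw [Real.rpow_neg (by positivity)]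
  norm_cast

theorem integrable_indicator_inv_norm (K : ℝ) :
    Integrable fun u : EuclideanSpace ℝ (Fin 2) => (Set.Iic K).indicator (·⁻¹) ‖u‖ := by
  rw [integrable_fun_norm_addHaar]
  have : IntegrableOn (fun y : ℝ => (Set.Ioc 0 K).indicator (fun _ => (1 : ℝ)) y) (Set.Ioi 0) :=
    ((integrable_indicator_iff measurableSet_Ioc).2 (by simp)).integrableOn
  refine this.congr_fun (fun y (hy : 0 < y) => ?_) measurableSet_Ioi
  by_cases hK : y ≤ K <;> simp [Set.indicator, hy, hK, hy.ne']

theorem integral_indicator_inv_norm {K : ℝ} (hK : 0 ≤ K) :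
    ∫ u : EuclideanSpace ℝ (Fin 2), (Set.Iic K).indicator (·⁻¹) ‖u‖ =
      2 * volume.real (Metric.ball (0 : EuclideanSpace ℝ (Fin 2)) 1) * K := by
  rw [integral_fun_norm_addHaar]
  have : ∫ y in Set.Ioi (0 : ℝ), y ^ (Module.finrank ℝ (EuclideanSpace ℝ (Fin 2)) - 1) •
      (Set.Iic K).indicator (·⁻¹) y = ∫ y in Set.Ioi (0 : ℝ), (Set.Iic K).indicator 1 y := by
    refine setIntegral_congr_fun measurableSet_Ioi fun y (hy : 0 < y) => ?_
    by_cases hK : y ≤ K <;> simp [Set.indicator, hK, hy.ne']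
  rw [this, setIntegral_indicator measurableSet_Iic, Set.Ioi_inter_Iic]
  simp [hK]
  ring

/-- Second-order Taylor estimate with the decay of the second derivative, for increments that are
small compared with the base point. -/
theorem SchwartzMap.abs_taylor_remainder_le {E : Type*} [NormedAddCommGroup E]
    [NormedSpace ℝ E] (ρ : 𝓢(E, ℝ)) {A K : ℝ} (hA : 0 ≤ A)
    (hρ : ∀ u, ‖fderivCLM ℝ E (E →L[ℝ] ℝ) (fderivCLM ℝ E ℝ ρ) u‖ ≤ A * ((1 + ‖u‖) ^ 4)⁻¹)
    (hK : 0 < K) {a h : E} (hh : ‖h‖ ≤ K) (ha : 2 * K ≤ 1 + ‖a‖) :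
    |ρ a - ρ (a - h) - fderiv ℝ ρ a h| ≤ 8 * A * K⁻¹ * ‖h‖ ^ 2 * ((1 + ‖a‖) ^ 3)⁻¹ := by
  set M := 8 * A * K⁻¹ * ((1 + ‖a‖) ^ 3)⁻¹ with hM
  set s := Metric.closedBall a ‖h‖
  have hconv : Convex ℝ s := convex_closedBall a ‖h‖
  have has : a ∈ s := Metric.mem_closedBall_self (norm_nonneg _)
  have hM0 : 0 ≤ M := by positivity
  have hD : ∀ p, HasFDerivAt (fderiv ℝ ρ)
      (fderivCLM ℝ E (E →L[ℝ] ℝ) (fderivCLM ℝ E ℝ ρ) p) p := fun p => by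
    rw [fderivCLM_apply]
    have := (fderivCLM ℝ E ℝ ρ).differentiableAt (x := p) |>.hasFDerivAt
    refine this.congr_of_eventuallyEq (.of_forall fun q => ?_)
    rw [fderivCLM_apply]
  have hD2 : ∀ p ∈ s, ‖fderivCLM ℝ E (E →L[ℝ] ℝ) (fderivCLM ℝ E ℝ ρ) p‖ ≤ M := fun p hp => by
    have hp : ‖a - p‖ ≤ K := by
      rw [norm_sub_rev, ← dist_eq_norm]
      exact (Metric.mem_closedBall.1 hp).trans hh
    have h1 : (1 + ‖a‖) / 2 ≤ 1 + ‖p‖ := by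
      have := norm_sub_norm_le a p
      linarith
    calc _ ≤ A * ((1 + ‖p‖) ^ 4)⁻¹ := hρ p
      _ ≤ A * (((1 + ‖a‖) / 2) ^ 4)⁻¹ := by gcongr
      _ = 16 * A * (1 + ‖a‖)⁻¹ * ((1 + ‖a‖) ^ 3)⁻¹ := by field_simp; norm_num
      _ ≤ 16 * A * (2 * K)⁻¹ * ((1 + ‖a‖) ^ 3)⁻¹ := by gcongr
      _ = M := by rw [hM, mul_inv]; ring
  have hD1 : ∀ p ∈ s, ‖fderiv ℝ ρ p - fderiv ℝ ρ a‖ ≤ M * ‖h‖ := fun p hp => by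
    refine (hconv.norm_image_sub_le_of_norm_hasFDerivWithin_le
      (fun q _ => (hD q).hasFDerivWithinAt) hD2 has hp).trans ?_
    rw [← dist_eq_norm]
    have := Metric.mem_closedBall.1 hp
    gcongr
  have hmem : a - h ∈ s := by simp [s]
  have := hconv.norm_image_sub_le_of_norm_fderiv_le' (𝕜 := ℝ) (f := ρ) (φ := fderiv ℝ ρ a)
    (fun p _ => ρ.differentiableAt) hD1 has hmem
  rw [sub_sub_cancel_left, norm_neg, map_neg, ← norm_neg, Real.norm_eq_abs] at this
  calc _ = |-(ρ (a - h) - ρ a - -(fderiv ℝ ρ a h))| := by congr 1; ring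
    _ ≤ _ := this
    _ = _ := by rw [hM]; ring

section Convolution

variable {v : EuclideanSpace ℝ (Fin 2) → ℝ} {x : EuclideanSpace ℝ (Fin 2)}

theorem inv_pow_sub_le (x y z : EuclideanSpace ℝ (Fin 2)) (n : ℕ) :
    ((1 + ‖y - z‖) ^ n)⁻¹ ≤ (1 + ‖x - y‖) ^ n * ((1 + ‖x - z‖) ^ n)⁻¹ := by
  rw [← inv_mul_le_iff₀ (by positivity)]
  exact inv_pow_mul_inv_pow_le x y z n

theorem integrable_smul_of_norm_le {F : Type*} [NormedAddCommGroup F] [NormedSpace ℝ F]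
    [SecondCountableTopologyEither (EuclideanSpace ℝ (Fin 2)) F]
    (hv : Measurable v) (hx : Integrable fun z => ((1 + ‖x - z‖) ^ 3)⁻¹ * |v z|)
    {g : EuclideanSpace ℝ (Fin 2) → F} (hg : Continuous g) {A : ℝ}
    (hA : ∀ u, ‖g u‖ ≤ A * ((1 + ‖u‖) ^ 3)⁻¹) (y : EuclideanSpace ℝ (Fin 2)) :
    Integrable fun z => v z • g (y - z) := by
  have hA0 : 0 ≤ A := by simpa using (norm_nonneg _).trans (hA 0)
  refine (hx.const_mul (A * (1 + ‖x - y‖) ^ 3)).mono' ?_ (.of_forall fun z => ?_)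
  · exact hv.aestronglyMeasurable.smul (hg.comp (by fun_prop)).aestronglyMeasurable
  · rw [norm_smul, Real.norm_eq_abs, mul_comm]
    calc _ ≤ A * ((1 + ‖x - y‖) ^ 3 * ((1 + ‖x - z‖) ^ 3)⁻¹) * |v z| := by
          gcongr
          exact (hA _).trans (by gcongr; exact inv_pow_sub_le x y z 3)
      _ = _ := by ring

theorem hasFDerivAt_convolution (hv : Measurable v)
    (hx : Integrable fun z => ((1 + ‖x - z‖) ^ 3)⁻¹ * |v z|)
    (ρ : 𝓢(EuclideanSpace ℝ (Fin 2), ℝ)) :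
    HasFDerivAt (fun y => ∫ z, ρ (y - z) * v z) (∫ z, v z • fderiv ℝ ρ (x - z)) x := by
  obtain ⟨A, hA⟩ := ρ.exists_norm_le_inv_one_add_pow 3
  obtain ⟨B, hB⟩ := (SchwartzMap.fderivCLM ℝ _ ℝ ρ).exists_norm_le_inv_one_add_pow 3
  simp only [SchwartzMap.fderivCLM_apply] at hB
  have hB0 : 0 ≤ B := by simpa using (norm_nonneg _).trans (hB 0)
  have hcont : Continuous (fderiv ℝ ρ) := (ρ.smooth 1).continuous_fderiv (by norm_num)
  refine hasFDerivAt_integral_of_dominated_of_fderiv_le (𝕜 := ℝ)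
    (F := fun y z => ρ (y - z) * v z) (F' := fun y z => v z • fderiv ℝ ρ (y - z))
    (bound := fun z => 8 * B * (((1 + ‖x - z‖) ^ 3)⁻¹ * |v z|))
    (Metric.ball_mem_nhds x one_pos) ?_ ?_ ?_ ?_ (hx.const_mul _) ?_
  · refine .of_forall fun y => ?_
    exact (ρ.continuous.comp (by fun_prop)).aestronglyMeasurable.mul hv.aestronglyMeasurable
  · simpa only [smul_eq_mul, mul_comm] using integrable_smul_of_norm_le hv hx ρ.continuous hA x
  · exact (integrable_smul_of_norm_le hv hx hcont hB x).aestronglyMeasurable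
  · refine .of_forall fun z y hy => ?_
    have hxy : ‖x - y‖ ≤ 1 := by
      rw [← dist_eq_norm, dist_comm]
      exact (Metric.mem_ball.1 hy).le
    rw [norm_smul, Real.norm_eq_abs, mul_comm]
    calc _ ≤ B * ((1 + 1) ^ 3 * ((1 + ‖x - z‖) ^ 3)⁻¹) * |v z| := by
          gcongr
          refine (hB _).trans ?_
          gcongr
          refine (inv_pow_sub_le x y z 3).trans ?_
          gcongr
      _ = _ := by ring
  · refine .of_forall fun z y _ => ?_
    have h1 : HasFDerivAt (fun y => ρ (y - z)) (fderiv ℝ ρ (y - z)) y := by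
      simpa [Function.comp_def] using (ρ.differentiableAt (x := y - z)).hasFDerivAt.comp y
        ((hasFDerivAt_id y).sub_const z)
    exact h1.mul_const (v z)

end Convolution

theorem abs_convolution_taylor_le {v : EuclideanSpace ℝ (Fin 2) → ℝ}
    {x : EuclideanSpace ℝ (Fin 2)} (hv : Measurable v)
    (hx : Integrable fun z => ((1 + ‖x - z‖) ^ 3)⁻¹ * |v z|)
    (ρ : 𝓢(EuclideanSpace ℝ (Fin 2), ℝ)) {A K : ℝ} (hA : 0 ≤ A)
    (hρ : ∀ u, ‖SchwartzMap.fderivCLM ℝ (EuclideanSpace ℝ (Fin 2))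
      (EuclideanSpace ℝ (Fin 2) →L[ℝ] ℝ) (SchwartzMap.fderivCLM ℝ _ ℝ ρ) u‖
        ≤ A * ((1 + ‖u‖) ^ 4)⁻¹)
    (hK : 0 < K) (hvK : ∀ᵐ z, v z ≠ 0 → 2 * K ≤ 1 + ‖x - z‖)
    {y : EuclideanSpace ℝ (Fin 2)} (hy : ‖x - y‖ ≤ K) :
    |(∫ z, ρ (x - z) * v z) - (∫ z, ρ (y - z) * v z) -
        fderiv ℝ (fun w => ∫ z, ρ (w - z) * v z) x (x - y)| ≤
      8 * A * K⁻¹ * ‖x - y‖ ^ 2 * ∫ z, ((1 + ‖x - z‖) ^ 3)⁻¹ * |v z| := by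
  obtain ⟨A₀, hA₀⟩ := ρ.exists_norm_le_inv_one_add_pow 3
  obtain ⟨B, hB⟩ := (SchwartzMap.fderivCLM ℝ _ ℝ ρ).exists_norm_le_inv_one_add_pow 3
  simp only [SchwartzMap.fderivCLM_apply] at hB
  have hcont : Continuous (fderiv ℝ ρ) := (ρ.smooth 1).continuous_fderiv (by norm_num)
  have hi : ∀ w, Integrable fun z => ρ (w - z) * v z := fun w => by
    simpa only [smul_eq_mul, mul_comm] using integrable_smul_of_norm_le hv hx ρ.continuous hA₀ w
  have hsub : Integrable fun z => ρ (x - z) * v z - ρ (y - z) * v z := (hi x).sub (hi y)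
  have hi' := integrable_smul_of_norm_le hv hx hcont hB x
  rw [(hasFDerivAt_convolution hv hx ρ).fderiv, ContinuousLinearMap.integral_apply hi',
    ← integral_sub (hi x) (hi y),
    ← integral_sub hsub (hi'.apply_continuousLinearMap _),
    ← Real.norm_eq_abs, ← integral_const_mul]
  refine norm_integral_le_of_norm_le (hx.const_mul _) ?_
  filter_upwards [hvK] with z hz
  rcases eq_or_ne (v z) 0 with h0 | h0
  · simp [h0]
  have := ρ.abs_taylor_remainder_le hA hρ hK hy (hz h0)
  rw [sub_sub_sub_cancel_left] at this
  calc _ = |ρ (x - z) - ρ (y - z) - fderiv ℝ ρ (x - z) (x - y)| * |v z| := by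
        rw [← abs_mul, Real.norm_eq_abs]
        congr 1
        simp only [_root_.smul_apply, smul_eq_mul]
        ring
    _ ≤ _ := by
        rw [← mul_assoc]
        gcongr

/-- Pointwise control of the singular integral of `ρ ∗ v` at a point at distance at least of the
order of the cutoff from the support of `v`. -/
theorem exists_abs_IopK_le (ρ : 𝓢(EuclideanSpace ℝ (Fin 2), ℝ)) (i j : Fin 2) :
    ∃ C : ℝ, 0 < C ∧ ∀ K : ℝ, 1 ≤ K → ∀ v : EuclideanSpace ℝ (Fin 2) → ℝ, Measurable v →
      ∀ x : EuclideanSpace ℝ (Fin 2), (∀ᵐ z, v z ≠ 0 → 2 * K ≤ 1 + ‖x - z‖) →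
      (Integrable fun z => ((1 + ‖x - z‖) ^ 3)⁻¹ * |v z|) →
      |IopK i j K (fun z => ∫ y, ρ (z - y) * v y) x| ≤
        C * ∫ z, ((1 + ‖x - z‖) ^ 3)⁻¹ * |v z| := by
  obtain ⟨A, hA⟩ := ρ.exists_norm_le_inv_one_add_pow 6
  obtain ⟨B, hB⟩ := (SchwartzMap.fderivCLM ℝ _ _
    (SchwartzMap.fderivCLM ℝ _ ℝ ρ)).exists_norm_le_inv_one_add_pow 4
  have hA0 : 0 ≤ A := by simpa using (norm_nonneg _).trans (hA 0)
  have hB0 : 0 ≤ B := by simpa using (norm_nonneg _).trans (hB 0)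
  set c := volume.real (Metric.ball (0 : EuclideanSpace ℝ (Fin 2)) 1)
  set I := ∫ u : EuclideanSpace ℝ (Fin 2), ((1 + ‖u‖) ^ 3)⁻¹
  have hc : 0 ≤ c := measureReal_nonneg
  have hI : 0 ≤ I := integral_nonneg fun u => by positivity
  refine ⟨64 * B * c + 64 * A * I + 1, by positivity, fun K hK v hv x hvK hx => ?_⟩
  have hK0 : 0 < K := by linarith
  set f : EuclideanSpace ℝ (Fin 2) → ℝ := fun z => ∫ y, ρ (z - y) * v y
  set φ : EuclideanSpace ℝ (Fin 2) → ℝ := fun z => ((1 + ‖x - z‖) ^ 3)⁻¹ * |v z|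
  set ω : EuclideanSpace ℝ (Fin 2) → ℝ := fun u => ((1 + ‖u‖) ^ 3)⁻¹ with hω
  set q := ∫ z, φ z with hq
  have hω0 : ∀ u, 0 ≤ ω u := fun u => by positivity
  have hω1 : ∀ u, ω u ≤ 1 := fun u => inv_le_one_of_one_le₀ (one_le_pow₀ (by simp))
  have hφ0 : ∀ z, 0 ≤ φ z := fun z => by positivity
  have hq0 : 0 ≤ q := integral_nonneg hφ0
  have hωi : Integrable ω := integrable_inv_one_add_norm_pow_three
  have hωc : Continuous ω := by
    refine Continuous.inv₀ (by fun_prop) fun u => by positivity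
  have hAω : ∀ u, |ρ u| ≤ A * (ω u * ω u) := fun u => by
    refine (hA u).trans_eq ?_
    rw [hω, ← mul_inv, ← pow_add]
  set H := MeasureTheory.convolution φ ω (ContinuousLinearMap.mul ℝ ℝ) volume
  have hH : ∀ y, H y = ∫ z, φ z * ω (y - z) := fun y => rfl
  have hHi : Integrable H := hx.integrable_convolution _ hωi
  have hHint : ∫ y, H y = q * I := integral_convolution _ hx hωi
  have hφω : ∀ y, Integrable fun z => φ z * ω (y - z) := fun y =>
    hx.mul_bdd (c := 1) (hωc.comp (by fun_prop)).aestronglyMeasurable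
      (.of_forall fun z => by rw [Real.norm_of_nonneg (hω0 _)]; exact hω1 _)
  have hfx : |f x| ≤ A * q := by
    rw [← Real.norm_eq_abs, hq, ← integral_const_mul]
    refine norm_integral_le_of_norm_le (hx.const_mul _) (.of_forall fun z => ?_)
    rw [norm_mul, Real.norm_eq_abs, Real.norm_eq_abs, ← mul_assoc]
    gcongr
    refine (hAω _).trans ?_
    gcongr
    exact mul_le_of_le_one_left (hω0 _) (hω1 _)
  have hfy : ∀ y, ω (x - y) * |f y| ≤ A * H y := fun y => by
    rw [← Real.norm_eq_abs, ← Real.norm_of_nonneg (hω0 (x - y)), ← norm_mul,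
      ← integral_const_mul, hH, ← integral_const_mul]
    refine norm_integral_le_of_norm_le ((hφω y).const_mul _) (.of_forall fun z => ?_)
    rw [norm_mul, norm_mul, Real.norm_of_nonneg (hω0 _), Real.norm_eq_abs, Real.norm_eq_abs]
    calc _ ≤ ω (x - y) * (A * (ω (y - z) * ω (y - z)) * |v z|) := by
          have := hω0 (x - y)
          gcongr
          exact hAω _
      _ = A * ((ω (x - y) * ω (y - z)) * |v z| * ω (y - z)) := by ring
      _ ≤ A * (ω (x - z) * |v z| * ω (y - z)) := by
          have := hω0 (y - z)
          gcongr
          exact inv_pow_mul_inv_pow_le x y z 3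
  set ψ : EuclideanSpace ℝ (Fin 2) → ℝ := fun u => (Set.Iic K).indicator (·⁻¹) ‖u‖
  have hψi : Integrable ψ := integrable_indicator_inv_norm K
  have hψ0 : ∀ u, 0 ≤ ψ u := fun u =>
    Set.indicator_apply_nonneg fun _ => inv_nonneg.2 (norm_nonneg _)
  have hψint : ∫ u, ψ u = 2 * c * K := integral_indicator_inv_norm hK0.le
  have hHy0 : ∀ y, 0 ≤ H y := fun y => integral_nonneg fun z => mul_nonneg (hφ0 _) (hω0 _)
  have hbound : ∀ y, ‖gam i j (x - y) *
      (f x - f y - (if ‖x - y‖ ≤ K then fderiv ℝ f x (x - y) else 0))‖ ≤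
      32 * B * K⁻¹ * q * ψ (x - y) + 32 * A * q * ω (x - y) + 32 * A * H y := fun y => by
    rw [norm_mul, Real.norm_eq_abs, Real.norm_eq_abs]
    have hg := abs_gam_le i j (x - y)
    have h1 : 0 ≤ 32 * B * K⁻¹ * q * ψ (x - y) := by have := hψ0 (x - y); positivity
    have h2 : 0 ≤ 32 * A * q * ω (x - y) := by positivity
    have h3 : 0 ≤ 32 * A * H y := by have := hHy0 y; positivity
    split_ifs with hy
    · have ht := abs_convolution_taylor_le hv hx ρ hB0 hB hK0 hvK hy
      calc _ ≤ 4 * (‖x - y‖ ^ 3)⁻¹ * (8 * B * K⁻¹ * ‖x - y‖ ^ 2 * q) := by gcongr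
        _ = 32 * B * K⁻¹ * q * ψ (x - y) := by
            have : ψ (x - y) = ‖x - y‖⁻¹ := Set.indicator_of_mem (Set.mem_Iic.2 hy) _
            rw [this]
            rcases eq_or_ne ‖x - y‖ 0 with h0 | h0
            · simp [h0]
            · field_simp
              ring
        _ ≤ _ := by linarith
    · rw [sub_zero]
      have hn : 1 ≤ ‖x - y‖ := hK.trans (not_le.1 hy).le
      have hw : (‖x - y‖ ^ 3)⁻¹ ≤ 8 * ω (x - y) := by
        calc (‖x - y‖ ^ 3)⁻¹ ≤ (((1 + ‖x - y‖) / 2) ^ 3)⁻¹ := by gcongr; linarith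
          _ = 8 * ω (x - y) := by rw [hω]; field_simp; norm_num
      calc _ ≤ 4 * (8 * ω (x - y)) * (A * q + |f y|) := by
            gcongr
            · exact hg.trans (by gcongr)
            · exact (abs_sub _ _).trans (by gcongr)
        _ = 32 * A * q * ω (x - y) + 32 * (ω (x - y) * |f y|) := by ring
        _ ≤ _ := by linarith [hfy y]
  have hi1 := (hψi.comp_sub_left x).const_mul (32 * B * K⁻¹ * q)
  have hi2 := (hωi.comp_sub_left x).const_mul (32 * A * q)
  have hi12 : Integrable fun y => 32 * B * K⁻¹ * q * ψ (x - y) + 32 * A * q * ω (x - y) :=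
    hi1.add hi2
  have hi3 := hHi.const_mul (32 * A)
  calc |IopK i j K f x| ≤ _ :=
        norm_integral_le_of_norm_le (hi12.add hi3) (.of_forall hbound)
    _ = 32 * B * K⁻¹ * q * (2 * c * K) + 32 * A * q * I + 32 * A * (q * I) := by
        rw [integral_add' hi12 hi3, integral_add hi1 hi2, integral_const_mul,
          integral_const_mul, integral_const_mul, integral_sub_left_eq_self ψ volume x,
          integral_sub_left_eq_self ω volume x, hψint, hHint]
    _ ≤ _ := by
        have : K⁻¹ * K = 1 := inv_mul_cancel₀ hK0.ne'
        linear_combination 64 * B * c * q * this + hq0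

/-- Large-scale estimate for the order-one multiplier part of the Dirichlet to
Neumann operator: `‖ 𝓘[ρ∗v] ‖_{L²(Σ_{k+1})} ≤ C (k²/m^{5/2}) S^{1/2}`. -/
theorem stmt19 (ρ : 𝓢(EuclideanSpace ℝ (Fin 2), ℝ)) (i j : Fin 2) :
    ∃ C > (0 : ℝ), ∀ k m : ℕ, 2 ≤ m → m ≤ k → ∀ S : ℝ, 0 ≤ S →
      ∀ v : EuclideanSpace ℝ (Fin 2) → ℝ, Measurable v →
      (∀ᵐ x, x ∈ Sig ((k : ℝ) + m) → v x = 0) →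
      (∀ l : ℕ, 1 ≤ l →
        ∫⁻ x in Sig ((k : ℝ) + m * (l + 1)) \ Sig ((k : ℝ) + m * l),
          ENNReal.ofReal (v x ^ 2) ≤ ENNReal.ofReal (((k : ℝ) + m * l) * S)) →
      (∫⁻ x in Sig ((k : ℝ) + 1),
          ENNReal.ofReal
            ((IopK i j ((m : ℝ) / 2) (fun z => ∫ y, ρ (z - y) * v y) x) ^ 2)) ^ ((1 : ℝ) / 2)
        ≤ ENNReal.ofReal (C * (k : ℝ) ^ 2 / (m : ℝ) ^ ((5 : ℝ) / 2) * Real.sqrt S) := by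
  obtain ⟨C₁, hC₁, h₁⟩ := exists_lintegral_weight_le
  obtain ⟨C₂, hC₂, h₂⟩ := exists_abs_IopK_le ρ i j
  refine ⟨4 * C₂ * C₁, by positivity, fun k m hm hmk S hS v hv hv0 hann => ?_⟩
  have hm0 : (2 : ℝ) ≤ m := by exact_mod_cast hm
  have hmk' : (m : ℝ) ≤ k := by exact_mod_cast hmk
  set b : ℝ := C₁ * k / (m : ℝ) ^ ((5 : ℝ) / 2) * √S with hb
  have hb0 : 0 ≤ b := by positivity
  have hpt : ∀ x ∈ Sig ((k : ℝ) + 1),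
      |IopK i j ((m : ℝ) / 2) (fun z => ∫ y, ρ (z - y) * v y) x| ≤ C₂ * b := fun x hx => by
    have hle := h₁ k m hm hmk S hS v hv hv0 hann x hx
    have hnn : ∀ z, 0 ≤ ((1 + ‖x - z‖) ^ 3)⁻¹ * |v z| := fun z => by positivity
    have hmeas : AEStronglyMeasurable (fun z => ((1 + ‖x - z‖) ^ 3)⁻¹ * |v z|) :=
      Measurable.aestronglyMeasurable (by fun_prop)
    have hwi : Integrable fun z => ((1 + ‖x - z‖) ^ 3)⁻¹ * |v z| :=
      (lintegral_ofReal_ne_top_iff_integrable hmeas (.of_forall hnn)).1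
        (hle.trans_lt ENNReal.ofReal_lt_top).ne
    refine (h₂ _ (by linarith) v hv x ?_ hwi).trans ?_
    · filter_upwards [hv0] with z hz hvz
      have := sub_le_norm_of_mem_Sig_of_notMem_Sig hx (mt hz hvz)
      linarith
    · gcongr
      rw [integral_eq_lintegral_of_nonneg_ae (.of_forall hnn) hmeas]
      exact ENNReal.toReal_le_of_le_ofReal hb0 hle
  calc _ ≤ (∫⁻ _ in Sig ((k : ℝ) + 1), ENNReal.ofReal ((C₂ * b) ^ 2)) ^ ((1 : ℝ) / 2) := by
        gcongr ?_ ^ _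
        refine setLIntegral_mono' (measurableSet_Sig _) fun x hx => ENNReal.ofReal_le_ofReal ?_
        rw [← sq_abs]
        gcongr
        exact hpt x hx
    _ = ENNReal.ofReal (C₂ * b * (2 * (k + 1))) := by
        rw [setLIntegral_const, volume_Sig (by positivity), ← ENNReal.ofReal_mul (by positivity),
          ENNReal.ofReal_rpow_of_nonneg (by positivity) (by norm_num), ← Real.sqrt_eq_rpow]
        congr 1
        rw [Real.sqrt_eq_iff_mul_self_eq (by positivity) (by positivity)]
        ring
    _ ≤ _ := by
        refine ENNReal.ofReal_le_ofReal ?_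
        calc C₂ * b * (2 * (k + 1)) ≤ C₂ * b * (2 * (k + k)) := by gcongr; linarith
          _ = _ := by rw [hb]; ring
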